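/- Every mixed extension of a finite strategic game has a Nash equilibrium (Nash's theorem). -/

import Mathlib

/-- `m` is a probability distribution on the finite type `A`. -/
def IsMixed {A : Type*} [Fintype A] (m : A → ℝ) : Prop :=
  (∀ a, 0 ≤ m a) ∧ ∑ a, m a = 1

/-- The multilinear extension of the payoff function `p` to joint mixed strategies. -/
noncomputable def mixedPayoff {ι : Type*} [Fintype ι] [DecidableEq ι]
    {S : ι → Type*} [∀ i, Fintype (S i)] [∀ i, DecidableEq (S i)]
    (p : (∀ i, S i) → ℝ) (m : ∀ i, S i → ℝ) : ℝ :=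
  ∑ s : ∀ i, S i, (∏ i, m i (s i)) * p s

section Scarf

open Finset

/-- If `c` maps `s` onto `E` and `s` has one element more than `E`, then exactly two elements of
`s` can be removed without destroying surjectivity. -/
lemma card_filter_image_erase_eq_two {α β : Type*} [DecidableEq α] [DecidableEq β]
    (c : α → β) (s : Finset α) (E : Finset β) (himg : s.image c = E) (hcard : #s = #E + 1) :
    #{x ∈ s | (s.erase x).image c = E} = 2 := by
  obtain ⟨x, hx, y, hy, hxy, hc⟩ := exists_ne_map_eq_of_card_lt_of_maps_to
    (s := s) (t := E) (f := c) (by omega) (fun a ha => by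
      rw [← himg]; exact mem_image_of_mem c ha)
  have erase_image : ∀ a ∈ s, ∀ b ∈ s, a ≠ b → c a = c b → (s.erase a).image c = E := by
    intro a _ b hb hab hcab
    rw [← himg]
    ext e
    simp only [mem_image, mem_erase]
    constructor
    · rintro ⟨z, ⟨_, hz⟩, rfl⟩
      exact ⟨z, hz, rfl⟩
    · rintro ⟨z, hz, rfl⟩
      by_cases hza : z = a
      · exact ⟨b, ⟨hab.symm, hb⟩, by rw [hza, hcab]⟩
      · exact ⟨z, ⟨hza, hz⟩, rfl⟩
  have inj : Set.InjOn c (s.erase x : Finset α) := by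
    rw [← card_image_iff, erase_image x hx y hy hxy hc, card_erase_of_mem hx]
    omega
  rw [card_eq_two]
  refine ⟨x, y, hxy, ?_⟩
  ext z
  simp only [mem_filter, mem_insert, mem_singleton]
  constructor
  · rintro ⟨hz, hze⟩
    by_contra! hne
    have : c z ∈ (s.erase z).image c := by
      rw [hze, ← himg]
      exact mem_image_of_mem c hz
    obtain ⟨w, hw, hwz⟩ := mem_image.1 this
    rw [mem_erase] at hw
    by_cases hwx : w = x
    · refine hne.2 (inj ?_ ?_ ?_)
      · simpa using ⟨hz, hne.1⟩
      · simpa using ⟨hy, hxy.symm⟩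
      · rw [← hwz, hwx, hc]
    · refine hw.1 (inj ?_ ?_ hwz)
      · simpa using ⟨hw.2, hwx⟩
      · simpa using ⟨hz, hne.1⟩
  · rintro (rfl | rfl)
    · exact ⟨hx, erase_image _ hx _ hy hxy hc⟩
    · exact ⟨hy, erase_image _ hy _ hx hxy.symm hc.symm⟩

variable {T I L : Type*} [LinearOrder L]

/-- Every point of `T` lies below all of `a.1` for one of the orders indexed by `a.2`. -/
def Dominant (u : I → T → L) (a : Finset T × Finset I) : Prop :=
  ∀ y, ∃ i ∈ a.2, ∀ x ∈ a.1, u i y ≤ u i x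

/-- The points of `a.1` carry all the colours in `a.2`, except possibly `i`. -/
def NearColorful (c : T → I) (i : I) (a : Finset T × Finset I) : Prop :=
  ∀ k ∈ a.2, k ≠ i → ∃ x ∈ a.1, c x = k

open Classical in
/-- `b` arises from `a` by adding a point or by removing an index. -/
def IsDoorOf (a b : Finset T × Finset I) : Prop :=
  (∃ x ∉ a.1, b = (insert x a.1, a.2)) ∨ (∃ l ∈ a.2, b = (a.1, a.2.erase l))

open Classical in
/-- The indices of `a.2` that are not needed to exhibit each point of `a.1` as a minimum. -/
noncomputable def spareIndices (u : I → T → L) (a : Finset T × Finset I) : Finset I :=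
  {l ∈ a.2 | ∀ x ∈ a.1, ∃ k ∈ a.2, k ≠ l ∧ ∀ z ∈ a.1, u k x ≤ u k z}

lemma mem_spareIndices {u : I → T → L} {a : Finset T × Finset I} {l : I} :
    l ∈ spareIndices u a ↔
      l ∈ a.2 ∧ ∀ x ∈ a.1, ∃ k ∈ a.2, k ≠ l ∧ ∀ z ∈ a.1, u k x ≤ u k z := by
  classical
  simp [spareIndices]

lemma card_spareIndices_of_nonempty {u : I → T → L} (hu : ∀ i, Function.Injective (u i))
    {a : Finset T × Finset I} (ha : Dominant u a) (hcard : #a.2 = #a.1 + 1)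
    (hne : a.1.Nonempty) : #(spareIndices u a) = 2 := by
  classical
  choose mn hmn hle using fun k => exists_min_image a.1 (u k) hne
  have eq_mn : ∀ k, ∀ x ∈ a.1, (∀ z ∈ a.1, u k x ≤ u k z) → mn k = x := fun k x hx h =>
    hu k (le_antisymm (hle k x hx) (h _ (hmn k)))
  have himg : a.2.image mn = a.1 := by
    ext x
    simp only [mem_image]
    constructor
    · rintro ⟨k, _, rfl⟩
      exact hmn k
    · intro hx
      obtain ⟨k, hk, h⟩ := ha x
      exact ⟨k, hk, eq_mn k x hx h⟩
  rw [← card_filter_image_erase_eq_two mn a.2 a.1 himg hcard]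
  congr 1
  ext l
  simp only [mem_spareIndices, mem_filter, and_congr_right_iff]
  intro _
  constructor
  · intro h
    ext x
    simp only [mem_image, mem_erase]
    constructor
    · rintro ⟨k, _, rfl⟩
      exact hmn k
    · intro hx
      obtain ⟨k, hk, hkl, h'⟩ := h x hx
      exact ⟨k, ⟨hkl, hk⟩, eq_mn k x hx h'⟩
  · intro h x hx
    rw [← h] at hx
    obtain ⟨k, hk, rfl⟩ := mem_image.1 hx
    rw [mem_erase] at hk
    exact ⟨k, hk.2, hk.1, hle k⟩

open Classical in
lemma card_rooms_of_door [Fintype T] [Nonempty T] [Fintype I] {u : I → T → L}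
    (hu : ∀ i, Function.Injective (u i)) {a : Finset T × Finset I} (ha : Dominant u a)
    (hcard : #a.2 = #a.1 + 1) :
    #{b | Dominant u b ∧ IsDoorOf a b} = #(spareIndices u a) := by
  obtain ⟨τ, D⟩ := a
  simp only at hcard
  let M : I → Finset T := fun l => {y | ∀ k ∈ D, k ≠ l → ∃ z ∈ τ, u k z < u k y}
  have mem_M : ∀ l y, y ∈ M l ↔ ∀ k ∈ D, k ≠ l → ∃ z ∈ τ, u k z < u k y := by simp [M]
  have le_of_mem_M : ∀ l y, y ∈ M l → l ∈ D ∧ ∀ z ∈ τ, u l y ≤ u l z := by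
    intro l y hy
    obtain ⟨k, hk, hky⟩ := ha y
    by_cases hkl : k = l
    · subst hkl; exact ⟨hk, hky⟩
    · obtain ⟨z, hz, hlt⟩ := (mem_M l y).1 hy k hk hkl
      exact absurd (hky z hz) (not_le.2 hlt)
  have M_disjoint : ∀ l l' y, y ∈ M l → y ∈ M l' → l = l' := by
    intro l l' y hy hy'
    by_contra hne
    obtain ⟨hl, h⟩ := le_of_mem_M l y hy
    obtain ⟨z, hz, hlt⟩ := (mem_M l' y).1 hy' l hl hne
    exact absurd (h z hz) (not_le.2 hlt)
  have not_mem_τ : ∀ l ∈ spareIndices u (τ, D), ∀ y ∈ M l, y ∉ τ := by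
    intro l hl y hy hyτ
    obtain ⟨k, hk, hkl, h⟩ := (mem_spareIndices.1 hl).2 y hyτ
    obtain ⟨z, hz, hlt⟩ := (mem_M l y).1 hy k hk hkl
    exact absurd (h z hz) (not_le.2 hlt)
  have exists_max : ∀ l, ∃ x, (M l).Nonempty → x ∈ M l ∧ ∀ y ∈ M l, u l y ≤ u l x := by
    intro l
    by_cases h : (M l).Nonempty
    · obtain ⟨x, hx⟩ := exists_max_image (M l) (u l) h
      exact ⟨x, fun _ => hx⟩
    · exact ⟨Classical.arbitrary T, fun h' => absurd h' h⟩
  choose X hX using exists_max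
  let g : I → Finset T × Finset I := fun l =>
    if (M l).Nonempty then (insert (X l) τ, D) else (τ, D.erase l)
  have g_pos : ∀ l, (M l).Nonempty → g l = (insert (X l) τ, D) := fun l h => if_pos h
  have g_neg : ∀ l, ¬ (M l).Nonempty → g l = (τ, D.erase l) := fun l h => if_neg h
  have mem_D : ∀ l ∈ spareIndices u (τ, D), l ∈ D := fun l hl => (mem_spareIndices.1 hl).1
  symm
  refine card_bij (fun l _ => g l) ?_ ?_ ?_
  · intro l hl
    have hlD := mem_D l hl
    simp only [mem_filter, mem_univ, true_and]
    by_cases h : (M l).Nonempty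
    · obtain ⟨hXM, hmax⟩ := hX l h
      rw [g_pos l h]
      refine ⟨fun y => ?_, Or.inl ⟨X l, not_mem_τ l hl _ hXM, rfl⟩⟩
      by_cases hy : y ∈ M l
      · refine ⟨l, hlD, fun x hx => ?_⟩
        rcases mem_insert.1 hx with rfl | hx
        · exact hmax y hy
        · exact (le_of_mem_M l y hy).2 x hx
      · rw [mem_M] at hy
        push Not at hy
        obtain ⟨k, hk, hkl, hky⟩ := hy
        refine ⟨k, hk, fun x hx => ?_⟩
        rcases mem_insert.1 hx with rfl | hx
        · obtain ⟨z, hz, hlt⟩ := (mem_M l _).1 hXM k hk hkl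
          exact (hky z hz).trans hlt.le
        · exact hky x hx
    · rw [g_neg l h]
      refine ⟨fun y => ?_, Or.inr ⟨l, hlD, rfl⟩⟩
      have hy : y ∉ M l := fun hy => h ⟨y, hy⟩
      rw [mem_M] at hy
      push Not at hy
      obtain ⟨k, hk, hkl, hky⟩ := hy
      exact ⟨k, mem_erase.2 ⟨hkl, hk⟩, hky⟩
  · intro l hl l' hl' heq
    have hne : ∀ k ∈ spareIndices u (τ, D), (M k).Nonempty → insert (X k) τ ≠ τ :=
      fun k hk h => fun e => not_mem_τ k hk _ (hX k h).1 (insert_eq_self.1 e)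
    by_cases h : (M l).Nonempty <;> by_cases h' : (M l').Nonempty
    · rw [g_pos l h, g_pos l' h', Prod.mk.injEq] at heq
      have hmem : X l ∈ insert (X l') τ := heq.1 ▸ mem_insert_self _ _
      rcases mem_insert.1 hmem with e | e
      · exact M_disjoint l l' (X l) (hX l h).1 (e ▸ (hX l' h').1)
      · exact absurd e (not_mem_τ l hl _ (hX l h).1)
    · rw [g_pos l h, g_neg l' h', Prod.mk.injEq] at heq
      exact absurd heq.1 (hne l hl h)
    · rw [g_neg l h, g_pos l' h', Prod.mk.injEq] at heq
      exact absurd heq.1.symm (hne l' hl' h')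
    · rw [g_neg l h, g_neg l' h', Prod.mk.injEq] at heq
      by_contra hll
      have : l ∈ D.erase l' := mem_erase.2 ⟨hll, mem_D l hl⟩
      rw [← heq.2] at this
      simp at this
  · intro b hb
    simp only [mem_filter, mem_univ, true_and] at hb
    obtain ⟨hdom, ⟨x, hx, rfl⟩ | ⟨l, hl, rfl⟩⟩ := hb
    · choose h hhD hh using hdom
      simp only at hx hhD hh
      have hinj : Set.InjOn h (insert x τ : Finset T) := by
        intro y hy z hz hyz
        exact hu (h y) (le_antisymm (hh y z hz) (hyz ▸ hh z y hy))
      have himg : (insert x τ).image h = D := by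
        refine eq_of_subset_of_card_le ?_ ?_
        · intro k hk
          obtain ⟨y, _, rfl⟩ := mem_image.1 hk
          exact hhD y
        · rw [card_image_of_injOn hinj, card_insert_of_notMem hx, hcard]
      have hxmem : x ∈ insert x τ := mem_insert_self _ _
      have hspare : h x ∈ spareIndices u (τ, D) := by
        refine mem_spareIndices.2 ⟨hhD x, fun y hy => ⟨h y, hhD y, fun e => ?_, fun z hz => ?_⟩⟩
        · have : y = x := hinj (mem_insert_of_mem hy) hxmem e
          exact hx (this ▸ hy)
        · exact hh y z (mem_insert_of_mem hz)
      have hxM : x ∈ M (h x) := by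
        rw [mem_M]
        intro k hk hkx
        rw [← himg] at hk
        obtain ⟨z, hz, rfl⟩ := mem_image.1 hk
        rcases mem_insert.1 hz with rfl | hzτ
        · exact absurd rfl hkx
        · refine ⟨z, hzτ, lt_of_le_of_ne (hh z x hxmem) fun e => ?_⟩
          exact hx (hu _ e ▸ hzτ)
      have hmax : ∀ y ∈ M (h x), u (h x) y ≤ u (h x) x := by
        intro y hy
        by_cases e : h y = h x
        · exact e ▸ hh y x hxmem
        · obtain ⟨z, hz, hlt⟩ := (mem_M _ _).1 hy (h y) (hhD y) e
          exact absurd (hh y z (mem_insert_of_mem hz)) (not_le.2 hlt)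
      have hMne : (M (h x)).Nonempty := ⟨x, hxM⟩
      have hXx : X (h x) = x :=
        hu (h x) (le_antisymm (hmax _ (hX _ hMne).1) ((hX _ hMne).2 x hxM))
      exact ⟨h x, hspare, by rw [g_pos _ hMne, hXx]⟩
    · have hspare : l ∈ spareIndices u (τ, D) := by
        refine mem_spareIndices.2 ⟨hl, fun y _ => ?_⟩
        obtain ⟨k, hk, hky⟩ := hdom y
        exact ⟨k, (mem_erase.1 hk).2, (mem_erase.1 hk).1, hky⟩
      have hM : ¬ (M l).Nonempty := by
        rintro ⟨y, hy⟩
        obtain ⟨k, hk, hky⟩ := hdom y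
        obtain ⟨z, hz, hlt⟩ := (mem_M _ _).1 hy k (mem_erase.1 hk).2 (mem_erase.1 hk).1
        exact absurd (hky z hz) (not_le.2 hlt)
      exact ⟨l, hspare, g_neg l hM⟩

lemma card_spareIndices_empty {u : I → T → L} {D : Finset I} (hD : #D = 1) :
    #(spareIndices u (∅, D)) = 1 := by
  simp [spareIndices, hD]

open Classical in
lemma card_doors_of_room [Fintype T] [Fintype I] {c : T → I} {i : I} {b : Finset T × Finset I}
    (hb : NearColorful c i b) (hcard : #b.2 = #b.1) (hncol : ¬ ∀ k ∈ b.2, ∃ x ∈ b.1, c x = k) :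
    #{a | NearColorful c i a ∧ IsDoorOf a b} = 2 := by
  obtain ⟨σ, C⟩ := b
  simp only at hcard hncol
  have hsub : C.erase i ⊆ σ.image c := by
    intro k hk
    rw [mem_erase] at hk
    obtain ⟨x, hx, rfl⟩ := hb k hk.2 hk.1
    exact mem_image_of_mem c hx
  obtain ⟨hiC, hiσ⟩ : i ∈ C ∧ i ∉ σ.image c := by
    push Not at hncol
    obtain ⟨k, hk, hkσ⟩ := hncol
    replace hkσ : k ∉ σ.image c := fun h => by
      obtain ⟨x, hx, hxk⟩ := mem_image.1 h
      exact hkσ x hx hxk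
    have : k = i := by
      by_contra hki
      exact hkσ (hsub (mem_erase.2 ⟨hki, hk⟩))
    subst this
    exact ⟨hk, hkσ⟩
  have hCe : #(C.erase i) + 1 = #σ := by rw [card_erase_add_one hiC, hcard]
  have iff_remove : ∀ x ∈ σ, NearColorful c i (σ.erase x, C) ↔
      C.erase i ⊆ (σ.erase x).image c := by
    intro x _
    simp only [NearColorful, subset_iff, mem_image, and_imp, mem_erase (s := C)]
    exact ⟨fun h k h1 h2 => h k h2 h1, fun h k h1 h2 => h h2 h1⟩
  by_cases himg : σ.image c = C.erase i
  · rw [← card_filter_image_erase_eq_two c σ (C.erase i) himg hCe.symm]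
    symm
    have sub : ∀ x, (σ.erase x).image c ⊆ C.erase i := fun x =>
      himg ▸ image_subset_image (erase_subset x σ)
    refine card_bij (fun x _ => (σ.erase x, C)) ?_ ?_ ?_
    · intro x hx
      simp only [mem_filter, mem_univ, true_and] at hx ⊢
      refine ⟨(iff_remove x hx.1).2 hx.2.ge, Or.inl ⟨x, by simp, by simp [insert_erase hx.1]⟩⟩
    · intro x hx y _ hxy
      simp only [mem_filter, Prod.mk.injEq, and_true] at hx hxy
      exact (erase_inj σ hx.1).1 hxy
    · intro a ha
      simp only [mem_filter, mem_univ, true_and] at ha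
      obtain ⟨hnc, ⟨x, hx, hab⟩ | ⟨l, hl, hab⟩⟩ := ha
      · obtain ⟨τ, D⟩ := a
        simp only [Prod.mk.injEq] at hab hx
        obtain ⟨rfl, rfl⟩ := hab
        have hxσ := mem_insert_self x τ
        refine ⟨x, mem_filter.2 ⟨hxσ, ?_⟩, by simp [erase_insert hx]⟩
        refine (sub x).antisymm ((iff_remove x hxσ).1 ?_)
        rwa [erase_insert hx]
      · obtain ⟨τ, D⟩ := a
        simp only [Prod.mk.injEq] at hab hl
        obtain ⟨rfl, rfl⟩ := hab
        have hli : l ≠ i := by rintro rfl; simp at hiC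
        obtain ⟨x, hx, hxl⟩ := hnc l hl hli
        have : c x ∈ ((D.erase l).erase i) := himg ▸ mem_image_of_mem c hx
        simp [hxl] at this
  · obtain ⟨hlt, hle⟩ : #(C.erase i) < #(σ.image c) ∧ #(σ.image c) ≤ #σ :=
      ⟨card_lt_card (hsub.ssubset_of_ne (Ne.symm himg)), card_image_le⟩
    have hinj : Set.InjOn c σ := card_image_iff.1 (by omega)
    obtain ⟨j, hj⟩ := card_eq_one.1
      (show #(σ.image c \ C.erase i) = 1 by rw [card_sdiff_of_subset hsub]; omega)
    have mem_j : ∀ k, k ∈ σ.image c → k ∉ C.erase i → k = j := fun k h1 h2 =>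
      mem_singleton.1 (hj ▸ mem_sdiff.2 ⟨h1, h2⟩)
    have hj' : j ∈ σ.image c \ C.erase i := hj ▸ mem_singleton_self j
    obtain ⟨hjσ, hjC⟩ := mem_sdiff.1 hj'
    have hji : j ≠ i := by rintro rfl; exact hiσ hjσ
    replace hjC : j ∉ C := fun h => hjC (mem_erase.2 ⟨hji, h⟩)
    obtain ⟨x, hx, hxj⟩ := mem_image.1 hjσ
    rw [card_eq_two]
    refine ⟨(σ.erase x, C), (σ, insert j C), fun e => ?_, ?_⟩
    · have : C = insert j C := congrArg Prod.snd e
      exact hjC (this ▸ mem_insert_self j C)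
    ext a
    simp only [mem_filter, mem_univ, true_and, mem_insert, mem_singleton]
    constructor
    · rintro ⟨hnc, ⟨y, hy, hab⟩ | ⟨l, hl, hab⟩⟩
      · left
        obtain ⟨τ, D⟩ := a
        simp only [Prod.mk.injEq] at hab hy
        obtain ⟨rfl, rfl⟩ := hab
        have hyσ := mem_insert_self y τ
        have hyj : c y = j := by
          refine mem_j _ (mem_image_of_mem c hyσ) fun hmem => ?_
          rw [mem_erase] at hmem
          obtain ⟨z, hz, hzy⟩ := hnc _ hmem.2 hmem.1
          have : z = y := hinj (mem_coe.2 (mem_insert_of_mem hz)) (mem_coe.2 hyσ) hzy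
          exact hy (this ▸ hz)
        have hxy : x = y := hinj hx hyσ (hxj.trans hyj.symm)
        rw [hxy, erase_insert hy]
      · right
        obtain ⟨τ, D⟩ := a
        simp only [Prod.mk.injEq] at hab hl
        obtain ⟨rfl, rfl⟩ := hab
        have hli : l ≠ i := by rintro rfl; simp at hiC
        obtain ⟨z, hz, hzl⟩ := hnc l hl hli
        have : l = j := mem_j l (hzl ▸ mem_image_of_mem c hz) (by simp)
        subst this
        rw [insert_erase hl]
    · rintro (rfl | rfl)
      · refine ⟨fun k hk hki => ?_, Or.inl ⟨x, by simp, by simp [insert_erase hx]⟩⟩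
        obtain ⟨z, hz, hzk⟩ := hb k hk hki
        refine ⟨z, mem_erase.2 ⟨?_, hz⟩, hzk⟩
        rintro rfl
        exact hjC (hxj ▸ hzk ▸ hk)
      · refine ⟨fun k hk hki => ?_, Or.inr ⟨j, by simp, by simp [erase_insert hjC]⟩⟩
        rcases mem_insert.1 hk with rfl | hk
        · exact ⟨x, hx, hxj⟩
        · exact hb k hk hki

/-- **Scarf's lemma**: for every colouring of a finite set by the indices of a family of linear
orders there is a dominant pair whose points carry all of its indices as colours. -/
theorem exists_dominant_colorful [Finite T] [Nonempty T] [Finite I]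
    {u : I → T → L} (hu : ∀ i, Function.Injective (u i)) (c : T → I) :
    ∃ a : Finset T × Finset I, Dominant u a ∧ ∀ k ∈ a.2, ∃ x ∈ a.1, c x = k := by
  classical
  cases nonempty_fintype T
  cases nonempty_fintype I
  by_contra hnone
  let i : I := c (Classical.arbitrary T)
  let doors : Finset (Finset T × Finset I) :=
    {a | Dominant u a ∧ NearColorful c i a ∧ #a.2 = #a.1 + 1}
  let rooms : Finset (Finset T × Finset I) :=
    {b | Dominant u b ∧ NearColorful c i b ∧ #b.2 = #b.1}
  have hcount := sum_card_bipartiteAbove_eq_sum_card_bipartiteBelow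
    (s := doors) (t := rooms) IsDoorOf
  have card_above : ∀ a ∈ doors, #(rooms.bipartiteAbove IsDoorOf a) = #(spareIndices u a) := by
    intro a ha
    simp only [doors, mem_filter, mem_univ, true_and] at ha
    obtain ⟨hdom, hnc, hcard⟩ := ha
    rw [← card_rooms_of_door hu hdom hcard]
    congr 1
    ext b
    simp only [bipartiteAbove, rooms, mem_filter, mem_univ, true_and]
    refine ⟨fun h => ⟨h.1.1, h.2⟩, fun h => ⟨⟨h.1, ?_⟩, h.2⟩⟩
    obtain ⟨-, ⟨x, hx, rfl⟩ | ⟨l, hl, rfl⟩⟩ := h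
    · refine ⟨fun k hk hki => ?_, by simp [card_insert_of_notMem hx, hcard]⟩
      obtain ⟨z, hz, hzk⟩ := hnc k hk hki
      exact ⟨z, mem_insert_of_mem hz, hzk⟩
    · exact ⟨fun k hk hki => hnc k (mem_erase.1 hk).2 hki, by
        simp [card_erase_of_mem hl, hcard]⟩
  have card_below : ∀ b ∈ rooms, #(doors.bipartiteBelow IsDoorOf b) = 2 := by
    intro b hb
    simp only [rooms, mem_filter, mem_univ, true_and] at hb
    obtain ⟨hdom, hnc, hcard⟩ := hb
    rw [← card_doors_of_room hnc hcard fun h => hnone ⟨b, hdom, h⟩]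
    congr 1
    ext a
    simp only [bipartiteBelow, doors, mem_filter, mem_univ, true_and]
    refine ⟨fun h => ⟨h.1.2.1, h.2⟩, fun h => ⟨⟨?_, h.1, ?_⟩, h.2⟩⟩
    · intro y
      obtain ⟨k, hk, hky⟩ := hdom y
      obtain ⟨-, ⟨x, hx, rfl⟩ | ⟨l, hl, rfl⟩⟩ := h
      · exact ⟨k, hk, fun z hz => hky z (mem_insert_of_mem hz)⟩
      · exact ⟨k, (mem_erase.1 hk).2, hky⟩
    · obtain ⟨-, ⟨x, hx, rfl⟩ | ⟨l, hl, rfl⟩⟩ := h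
      · simpa [card_insert_of_notMem hx] using hcard
      · simp only at hcard
        rw [← hcard, card_erase_add_one hl]
  have hout : ((∅, {i}) : Finset T × Finset I) ∈ doors := by
    refine mem_filter.2 ⟨mem_univ _, fun y => ?_, fun k hk hki => ?_, by simp⟩
    · simp
    · exact absurd (mem_singleton.1 hk) hki
  rw [sum_congr rfl card_above, sum_congr rfl card_below, ← add_sum_erase _ _ hout,
    card_spareIndices_empty (card_singleton i), sum_congr rfl (g := fun _ => 2)] at hcount
  · simp only [sum_const, smul_eq_mul] at hcount
    omega
  · intro a ha
    simp only [doors, mem_erase, mem_filter, mem_univ, true_and] at ha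
    obtain ⟨hne, hdom, hnc, hcard⟩ := ha
    refine card_spareIndices_of_nonempty hu hdom hcard (nonempty_iff_ne_empty.2 fun h => hne ?_)
    obtain ⟨τ, D⟩ := a
    simp only at h hcard
    subst h
    obtain ⟨l, rfl⟩ := card_eq_one.1 (by simpa using hcard)
    have : l = i := by
      by_contra hli
      obtain ⟨x, hx, _⟩ := hnc l (mem_singleton_self l) hli
      simp at hx
    rw [this]

end Scarf

section Brouwer

open Finset

variable {I : Type*} [Fintype I]

lemma exists_apply_le_of_mem_stdSimplex {x y : I → ℝ} (hx : x ∈ stdSimplex ℝ I)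
    (hy : y ∈ stdSimplex ℝ I) : ∃ i, x i ≤ y i := by
  by_contra! h
  have hne : (univ : Finset I).Nonempty := by
    by_contra he
    rw [not_nonempty_iff_eq_empty] at he
    have := hx.2
    simp [he] at this
  have := sum_lt_sum_of_nonempty hne fun i _ => h i
  rw [hx.2, hy.2] at this
  exact lt_irrefl _ this

/-- For a colouring of the standard simplex there is a finite cluster of points of diameter at
most `|I| δ` in which every colour occurs, except for colours whose coordinate nearly vanishes. -/
lemma exists_small_colorful [Nonempty I] (c : (I → ℝ) → I) {δ : ℝ} (hδ : 0 < δ) :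
    ∃ σ : Finset (I → ℝ), ∃ C : Finset I, σ.Nonempty ∧ (↑σ ⊆ stdSimplex ℝ I) ∧
      (∀ k ∈ C, ∃ x ∈ σ, c x = k) ∧
      (∀ x ∈ σ, ∀ y ∈ σ, ∀ i ∈ C, x i ≤ y i + Fintype.card I * δ) ∧
      (∀ x ∈ σ, ∀ i ∉ C, x i ≤ Fintype.card I * δ) := by
  classical
  obtain ⟨N, hNsub, hNfin, hNcov⟩ := (isCompact_stdSimplex ℝ I).finite_cover_balls hδ
  have : Finite N := hNfin
  have net : ∀ y ∈ stdSimplex ℝ I, ∃ z : N, ∀ i, y i ≤ z.1 i + δ := by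
    intro y hy
    obtain ⟨z, hz, hyz⟩ := Set.mem_iUnion₂.1 (hNcov hy)
    refine ⟨⟨z, hz⟩, fun i => ?_⟩
    have := (dist_le_pi_dist y z i).trans (Metric.mem_ball.1 hyz).le
    rw [Real.dist_eq, abs_le] at this
    linarith [this.2]
  have : Nonempty N := ⟨(net _ (single_mem_stdSimplex ℝ (Classical.arbitrary I))).choose⟩
  let u : I → N → ℝ ×ₗ Fin (Nat.card N) := fun i x => toLex (x.1 i, Finite.equivFin N x)
  have hu : ∀ i, Function.Injective (u i) := fun i x y h => by
    have h' := congrArg (fun p => (ofLex p).2) h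
    exact (Finite.equivFin N).injective h'
  have apply_le_of_u_le : ∀ i (x y : N), u i x ≤ u i y → x.1 i ≤ y.1 i := fun i x y h =>
    Prod.Lex.monotone_fst (u i x) (u i y) h
  obtain ⟨⟨σ, C⟩, hdom, hcol⟩ := exists_dominant_colorful hu fun x => c x.1
  have hCne : C.Nonempty := by
    obtain ⟨i, hi, _⟩ := hdom (Classical.arbitrary N)
    exact ⟨i, hi⟩
  have hσne : σ.Nonempty := by
    obtain ⟨i, hi⟩ := hCne
    obtain ⟨x, hx, _⟩ := hcol i hi
    exact ⟨x, hx⟩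
  choose m hmσ hm using fun i => exists_min_image σ (fun x => x.1 i) hσne
  have hcardC : (0 : ℝ) < #C := by exact_mod_cast hCne.card_pos
  have hsum_le : ∀ x ∈ σ, ∑ i ∈ C, (m i).1 i ≤ ∑ i ∈ C, x.1 i := fun x hx =>
    sum_le_sum fun i _ => hm i x hx
  have hC_le_one : ∀ x ∈ σ, ∑ i ∈ C, x.1 i ≤ 1 := fun x _ => by
    rw [← (hNsub x.2).2]
    exact sum_le_sum_of_subset_of_nonneg (subset_univ C) fun i _ _ => (hNsub x.2).1 i
  set slack : ℝ := 1 - ∑ i ∈ C, (m i).1 i with hslack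
  have hslack_nonneg : 0 ≤ slack := by
    obtain ⟨x, hx⟩ := hσne
    linarith [hsum_le x hx, hC_le_one x hx]
  have hslack_le : slack ≤ Fintype.card I * δ := by
    let y : I → ℝ := fun i => if i ∈ C then (m i).1 i + slack / #C else 0
    have hy : y ∈ stdSimplex ℝ I := by
      constructor
      · intro i
        have := (hNsub (m i).2).1 i
        simp only [y]
        split_ifs <;> positivity
      · simp only [y]
        rw [← sum_filter, filter_mem_eq_inter, univ_inter, sum_add_distrib, sum_const,
          nsmul_eq_mul, mul_div_cancel₀ _ hcardC.ne', hslack]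
        ring
    obtain ⟨z, hz⟩ := net y hy
    obtain ⟨i, hi, hdom_i⟩ := hdom z
    have h1 := apply_le_of_u_le i _ _ (hdom_i (m i) (hmσ i))
    have h2 := hz i
    simp only [y, if_pos hi] at h2
    have h3 : slack / #C ≤ δ := by linarith
    rw [div_le_iff₀ hcardC, mul_comm] at h3
    refine h3.trans (mul_le_mul_of_nonneg_right ?_ hδ.le)
    exact_mod_cast card_le_univ C
  have hcompl : ∀ x : N, ∑ i ∈ C, x.1 i + ∑ i ∈ Cᶜ, x.1 i = 1 := fun x => by
    rw [sum_add_sum_compl, (hNsub x.2).2]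
  refine ⟨σ.image Subtype.val, C, hσne.image _, ?_, ?_, ?_, ?_⟩
  · intro x hx
    obtain ⟨z, _, rfl⟩ := mem_image.1 (mem_coe.1 hx)
    exact hNsub z.2
  · intro k hk
    obtain ⟨x, hx, hxk⟩ := hcol k hk
    exact ⟨x.1, mem_image_of_mem _ hx, hxk⟩
  · intro x hx y hy i hi
    obtain ⟨x, hxσ, rfl⟩ := mem_image.1 hx
    obtain ⟨y, hyσ, rfl⟩ := mem_image.1 hy
    have h1 : x.1 i - (m i).1 i ≤ ∑ j ∈ C, (x.1 j - (m j).1 j) :=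
      single_le_sum (f := fun j => x.1 j - (m j).1 j)
        (fun j _ => sub_nonneg.2 (hm j x hxσ)) hi
    rw [sum_sub_distrib] at h1
    linarith [hm i y hyσ, hC_le_one x hxσ]
  · intro x hx i hi
    obtain ⟨x, hxσ, rfl⟩ := mem_image.1 hx
    have h1 : x.1 i ≤ ∑ j ∈ Cᶜ, x.1 j :=
      single_le_sum (fun j _ => (hNsub x.2).1 j) (mem_compl.2 hi)
    linarith [hcompl x, hsum_le x hxσ]

/-- **Brouwer's fixed point theorem** for the standard simplex. -/
theorem exists_fixedPoint_stdSimplex [Nonempty I] {f : (I → ℝ) → I → ℝ}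
    (hf : ContinuousOn f (stdSimplex ℝ I))
    (hmaps : Set.MapsTo f (stdSimplex ℝ I) (stdSimplex ℝ I)) :
    ∃ x ∈ stdSimplex ℝ I, f x = x := by
  classical
  have hcpt := isCompact_stdSimplex ℝ I
  have hcolor : ∀ x, ∃ i, x ∈ stdSimplex ℝ I → x i ≤ f x i := fun x => by
    by_cases hx : x ∈ stdSimplex ℝ I
    · obtain ⟨i, hi⟩ := exists_apply_le_of_mem_stdSimplex hx (hmaps hx)
      exact ⟨i, fun _ => hi⟩
    · exact ⟨Classical.arbitrary I, fun h => absurd h hx⟩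
  choose c hc using hcolor
  have happrox : ∀ ε > 0, ∃ x ∈ stdSimplex ℝ I, ∀ i, x i ≤ f x i + ε := by
    intro ε hε
    obtain ⟨η, hη, hunif⟩ := Metric.uniformContinuousOn_iff_le.1
      (hcpt.uniformContinuousOn_of_continuous hf) (ε / 2) (half_pos hε)
    have hI : (0 : ℝ) < Fintype.card I := by exact_mod_cast Fintype.card_pos
    set θ := min η (ε / 2)
    have hθpos : 0 < θ := lt_min hη (half_pos hε)
    obtain ⟨σ, C, ⟨x, hx⟩, hσ, hcol, hclose, hsmall⟩ :=
      exists_small_colorful c (div_pos hθpos hI)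
    rw [mul_div_cancel₀ _ hI.ne'] at hclose hsmall
    refine ⟨x, hσ hx, fun i => ?_⟩
    by_cases hi : i ∈ C
    · obtain ⟨y, hy, hyi⟩ := hcol i hi
      have h1 : y i ≤ f y i := hyi ▸ hc y (hσ hy)
      have h2 : dist x y ≤ η := by
        refine (dist_pi_le_iff hη.le).2 fun j => ?_
        rw [Real.dist_eq, abs_le]
        have hθη : θ ≤ η := min_le_left _ _
        by_cases hj : j ∈ C
        · have := hclose x hx y hy j hj
          have := hclose y hy x hx j hj
          constructor <;> linarith
        · have := hsmall x hx j hj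
          have := hsmall y hy j hj
          have := (hσ hx).1 j
          have := (hσ hy).1 j
          constructor <;> linarith
      have h3 : dist (f x i) (f y i) ≤ ε / 2 :=
        (dist_le_pi_dist _ _ i).trans (hunif x (hσ hx) y (hσ hy) h2)
      rw [Real.dist_eq, abs_le] at h3
      have h4 := hclose x hx y hy i hi
      have h5 : θ ≤ ε / 2 := min_le_right _ _
      linarith [h3.1]
    · have h1 := hsmall x hx i hi
      have h2 := (hmaps (hσ hx)).1 i
      have h5 : θ ≤ ε / 2 := min_le_right _ _
      linarith
  obtain ⟨x, hx, hmin⟩ := hcpt.exists_isMinOn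
    (f := fun x => ∑ i, max (x i - f x i) 0) (by
      obtain ⟨x, hx, _⟩ := happrox 1 one_pos
      exact ⟨x, hx⟩) (by
      refine continuousOn_finsetSum _ fun i _ => ?_
      have h1 : ContinuousOn (fun x => f x i) (stdSimplex ℝ I) :=
        (continuous_apply i).comp_continuousOn hf
      fun_prop)
  have hzero : ∑ i, max (x i - f x i) 0 ≤ 0 := by
    refine le_of_forall_pos_le_add fun ε hε => ?_
    have hI : (0 : ℝ) < Fintype.card I := by exact_mod_cast Fintype.card_pos
    obtain ⟨y, hy, hle⟩ := happrox (ε / Fintype.card I) (div_pos hε hI)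
    calc ∑ i, max (x i - f x i) 0 ≤ ∑ i, max (y i - f y i) 0 := hmin hy
      _ ≤ ∑ _i : I, ε / Fintype.card I :=
        sum_le_sum fun i _ => max_le (by linarith [hle i]) (by positivity)
      _ = 0 + ε := by
        rw [sum_const, card_univ, nsmul_eq_mul, mul_div_cancel₀ _ hI.ne', zero_add]
  have hle : ∀ i, x i ≤ f x i := fun i => by
    have := (sum_eq_zero_iff_of_nonneg fun i _ => le_max_right (x i - f x i) 0).1
      (le_antisymm hzero (sum_nonneg fun i _ => le_max_right _ _)) i (mem_univ i)
    linarith [le_max_left (x i - f x i) 0]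
  refine ⟨x, hx, ?_⟩
  have := (sum_eq_sum_iff_of_le fun i _ => hle i).1 (hx.2.trans (hmaps hx).2.symm)
  exact funext fun i => (this i (mem_univ i)).symm

end Brouwer

section Nash

open Finset

variable {ι : Type*} {S : ι → Type*} [∀ i, Fintype (S i)]

/-- Normalises a family of nonnegative weights to a family of probability vectors; it fixes every
family of probability vectors. -/
noncomputable def normalizeMixed (w : ∀ i, S i → ℝ) : ∀ i, S i → ℝ := fun i s =>
  (w i s + max (1 - ∑ t, w i t) 0 / Fintype.card (S i)) / max 1 (∑ t, w i t)

lemma isMixed_normalizeMixed [∀ i, Nonempty (S i)] {w : ∀ i, S i → ℝ} (hw : ∀ i s, 0 ≤ w i s)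
    (i : ι) : IsMixed (normalizeMixed w i) := by
  have hmax : 0 < max 1 (∑ t, w i t) := lt_max_of_lt_left one_pos
  have hcard : (Fintype.card (S i) : ℝ) ≠ 0 := by exact_mod_cast Fintype.card_ne_zero
  constructor
  · intro s
    have := hw i s
    unfold normalizeMixed
    positivity
  · simp only [normalizeMixed]
    rw [← sum_div, sum_add_distrib, sum_const, card_univ, nsmul_eq_mul, mul_div_cancel₀ _ hcard,
      div_eq_one_iff_eq hmax.ne']
    rcases le_total 1 (∑ t, w i t) with h | h
    · rw [max_eq_right h, max_eq_right (by linarith), add_zero]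
    · rw [max_eq_left h, max_eq_left (by linarith)]
      ring

lemma normalizeMixed_eq_self {w : ∀ i, S i → ℝ} (hw : ∀ i, IsMixed (w i)) :
    normalizeMixed w = w := by
  funext i s
  simp [normalizeMixed, (hw i).2]

lemma continuous_normalizeMixed :
    Continuous (normalizeMixed : (∀ i, S i → ℝ) → ∀ i, S i → ℝ) := by
  refine continuous_pi fun i => continuous_pi fun s => ?_
  unfold normalizeMixed
  refine Continuous.div (by fun_prop) (by fun_prop) fun w => ?_
  exact ne_of_gt (lt_max_of_lt_left one_pos)

/-- Brouwer's fixed point theorem for a product of simplices. -/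
theorem exists_fixedPoint_isMixed [Fintype ι] [∀ i, Nonempty (S i)]
    {f : (∀ i, S i → ℝ) → ∀ i, S i → ℝ}
    (hf : ContinuousOn f {m | ∀ i, IsMixed (m i)})
    (hmaps : ∀ m, (∀ i, IsMixed (m i)) → ∀ i, IsMixed (f m i)) :
    ∃ m, (∀ i, IsMixed (m i)) ∧ f m = m := by
  cases isEmpty_or_nonempty ι with
  | inl h => exact ⟨fun i => h.elim i, fun i => h.elim i, funext fun i => h.elim i⟩
  | inr h =>
    have : Nonempty (Σ i, S i) := ⟨⟨h.some, Classical.arbitrary _⟩⟩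
    have hι : (Fintype.card ι : ℝ) ≠ 0 := by exact_mod_cast Fintype.card_ne_zero
    let expand : ((Σ i, S i) → ℝ) → ∀ i, S i → ℝ := fun x i s => Fintype.card ι * x ⟨i, s⟩
    have hnorm : ∀ x ∈ stdSimplex ℝ (Σ i, S i), ∀ i, IsMixed (normalizeMixed (expand x) i) :=
      fun x hx => isMixed_normalizeMixed fun i s => mul_nonneg (Nat.cast_nonneg _) (hx.1 _)
    let F : ((Σ i, S i) → ℝ) → (Σ i, S i) → ℝ := fun x a =>
      f (normalizeMixed (expand x)) a.1 a.2 / Fintype.card ι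
    have hexpand : ∀ x, expand (F x) = f (normalizeMixed (expand x)) := fun x => by
      funext i s
      simp only [expand, F]
      field_simp
    have hexpand_cont : Continuous expand := by
      refine continuous_pi fun i => continuous_pi fun s => ?_
      fun_prop
    obtain ⟨x, hx, hfix⟩ := exists_fixedPoint_stdSimplex (f := F) (by
      have h1 : ContinuousOn (fun x => f (normalizeMixed (expand x)))
          (stdSimplex ℝ (Σ i, S i)) :=
        hf.comp (continuous_normalizeMixed.comp hexpand_cont).continuousOn hnorm
      refine continuousOn_pi.2 fun a => ?_
      exact (continuousOn_pi.1 (continuousOn_pi.1 h1 a.1) a.2).div_const _) (by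
      intro x hx
      have hmix := hmaps _ (hnorm x hx)
      refine ⟨fun a => div_nonneg ((hmix a.1).1 a.2) (Nat.cast_nonneg _), ?_⟩
      simp only [F]
      rw [← sum_div, Fintype.sum_sigma]
      simp only [(hmix _).2]
      simp [hι])
    have hmix := hmaps _ (hnorm x hx)
    have hx' : expand x = f (normalizeMixed (expand x)) := by rw [← hexpand, hfix]
    refine ⟨expand x, fun i => hx' ▸ hmix i, ?_⟩
    have hself : normalizeMixed (expand x) = expand x :=
      normalizeMixed_eq_self fun i => hx' ▸ hmix i
    rw [hself] at hx'
    exact hx'.symm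

variable [Fintype ι] [DecidableEq ι] [∀ i, DecidableEq (S i)]

lemma mixedPayoff_update (p : (∀ i, S i) → ℝ) (m : ∀ i, S i → ℝ) (i : ι) (q : S i → ℝ) :
    mixedPayoff p (Function.update m i q) =
      ∑ t, q t * mixedPayoff p (Function.update m i (Pi.single t 1)) := by
  have hprod : ∀ (r : S i → ℝ) (s : ∀ j, S j), ∏ j, Function.update m i r j (s j) =
      r (s i) * ∏ j ∈ univ.erase i, m j (s j) := by
    intro r s
    rw [← mul_prod_erase univ _ (mem_univ i), Function.update_self]
    congr 1
    refine prod_congr rfl fun j hj => ?_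
    rw [Function.update_of_ne (ne_of_mem_erase hj)]
  simp only [mixedPayoff, hprod, mul_sum]
  rw [sum_comm]
  refine sum_congr rfl fun s _ => ?_
  rw [Fintype.sum_eq_single (s i)]
  · simp [mul_assoc]
  · intro t ht
    simp [ht.symm]

lemma continuous_mixedPayoff (p : (∀ i, S i) → ℝ) : Continuous (mixedPayoff p) := by
  unfold mixedPayoff
  fun_prop

/-- The gain of player `i` from deviating to the pure strategy `s`, if positive. -/
noncomputable def pureGain (p : ι → (∀ i, S i) → ℝ) (m : ∀ i, S i → ℝ) (i : ι) (s : S i) : ℝ :=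
  max (mixedPayoff (p i) (Function.update m i (Pi.single s 1)) - mixedPayoff (p i) m) 0

lemma pureGain_nonneg (p : ι → (∀ i, S i) → ℝ) (m : ∀ i, S i → ℝ) (i : ι) (s : S i) :
    0 ≤ pureGain p m i s :=
  le_max_right _ _

lemma continuous_pureGain (p : ι → (∀ i, S i) → ℝ) (i : ι) (s : S i) :
    Continuous fun m => pureGain p m i s := by
  have h := continuous_mixedPayoff (p i)
  have h' : Continuous fun m : ∀ i, S i → ℝ => Function.update m i (Pi.single s 1) :=
    continuous_id.update i continuous_const
  exact ((h.comp h').sub h).max continuous_const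

lemma exists_pos_pureGain_eq_zero (p : ι → (∀ i, S i) → ℝ) {m : ∀ i, S i → ℝ} {i : ι}
    (hm : IsMixed (m i)) : ∃ s, 0 < m i s ∧ pureGain p m i s = 0 := by
  by_contra! h
  have hlt : ∀ s, 0 < m i s →
      mixedPayoff (p i) m < mixedPayoff (p i) (Function.update m i (Pi.single s 1)) := by
    intro s hs
    by_contra! hle
    exact h s hs (max_eq_right (sub_nonpos.2 hle))
  obtain ⟨s, -, hs⟩ : ∃ s ∈ univ, 0 < m i s := by
    refine exists_lt_of_sum_lt (f := fun _ => (0 : ℝ)) ?_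
    rw [hm.2]
    simp
  have hsum : ∑ t, m i t * mixedPayoff (p i) m <
      ∑ t, m i t * mixedPayoff (p i) (Function.update m i (Pi.single t 1)) := by
    refine sum_lt_sum (fun t _ => ?_) ⟨s, mem_univ s, mul_lt_mul_of_pos_left (hlt s hs) hs⟩
    rcases (hm.1 t).eq_or_lt with h0 | h0
    · simp [← h0]
    · exact (mul_lt_mul_of_pos_left (hlt t h0) h0).le
  rw [← mixedPayoff_update, Function.update_eq_self, ← sum_mul, hm.2, one_mul] at hsum
  exact lt_irrefl _ hsum

/-- Nash's map, which shifts weight towards profitable pure deviations. -/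
noncomputable def nashMap (p : ι → (∀ i, S i) → ℝ) (m : ∀ i, S i → ℝ) : ∀ i, S i → ℝ := fun i s =>
  (m i s + pureGain p m i s) / (1 + ∑ t, pureGain p m i t)

lemma one_add_sum_pureGain_pos (p : ι → (∀ i, S i) → ℝ) (m : ∀ i, S i → ℝ) (i : ι) :
    0 < 1 + ∑ t, pureGain p m i t :=
  add_pos_of_pos_of_nonneg one_pos (sum_nonneg fun t _ => pureGain_nonneg p m i t)

lemma continuous_nashMap (p : ι → (∀ i, S i) → ℝ) : Continuous (nashMap p) := by
  refine continuous_pi fun i => continuous_pi fun s => ?_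
  have h := continuous_pureGain p i
  exact Continuous.div (by fun_prop) (by fun_prop) fun m => (one_add_sum_pureGain_pos p m i).ne'

lemma isMixed_nashMap (p : ι → (∀ i, S i) → ℝ) {m : ∀ i, S i → ℝ} {i : ι} (hm : IsMixed (m i)) :
    IsMixed (nashMap p m i) := by
  have hpos := one_add_sum_pureGain_pos p m i
  refine ⟨fun s => div_nonneg (add_nonneg (hm.1 s) (pureGain_nonneg p m i s)) hpos.le, ?_⟩
  simp only [nashMap]
  rw [← sum_div, sum_add_distrib, hm.2, div_self hpos.ne']

lemma pureGain_eq_zero_of_nashMap_eq {p : ι → (∀ i, S i) → ℝ} {m : ∀ i, S i → ℝ}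
    (hfix : nashMap p m = m) {i : ι} (hm : IsMixed (m i)) (s : S i) : pureGain p m i s = 0 := by
  obtain ⟨t, htpos, ht⟩ := exists_pos_pureGain_eq_zero p hm
  have h := congrFun (congrFun hfix i) t
  rw [nashMap, div_eq_iff (one_add_sum_pureGain_pos p m i).ne', ht] at h
  have hsum : ∑ t, pureGain p m i t = 0 := by
    refine (mul_eq_zero.1 ?_).resolve_left htpos.ne'
    linarith
  exact (sum_eq_zero_iff_of_nonneg fun t _ => pureGain_nonneg p m i t).1 hsum s (mem_univ s)

end Nash

/-- Nash's theorem: every mixed extension of a finite strategic game has a Nash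
equilibrium. -/
theorem stmt13 {ι : Type*} [Fintype ι] [DecidableEq ι] {S : ι → Type*}
    [∀ i, Fintype (S i)] [∀ i, DecidableEq (S i)] [∀ i, Nonempty (S i)]
    (p : ι → (∀ i, S i) → ℝ) :
    ∃ m : ∀ i, S i → ℝ, (∀ i, IsMixed (m i)) ∧
      ∀ i (m' : S i → ℝ), IsMixed m' →
        mixedPayoff (p i) m ≥ mixedPayoff (p i) (Function.update m i m') := by
  obtain ⟨m, hm, hfix⟩ := exists_fixedPoint_isMixed (continuous_nashMap p).continuousOn
    fun m hm i => isMixed_nashMap p (hm i)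
  refine ⟨m, hm, fun i m' hm' => ?_⟩
  have hle : ∀ s, mixedPayoff (p i) (Function.update m i (Pi.single s 1)) ≤
      mixedPayoff (p i) m := fun s =>
    sub_nonpos.1 (max_eq_right_iff.1 (pureGain_eq_zero_of_nashMap_eq hfix (hm i) s))
  calc mixedPayoff (p i) (Function.update m i m')
      = ∑ s, m' s * mixedPayoff (p i) (Function.update m i (Pi.single s 1)) :=
        mixedPayoff_update _ _ _ _
    _ ≤ ∑ s, m' s * mixedPayoff (p i) m :=
        Finset.sum_le_sum fun s _ => mul_le_mul_of_nonneg_left (hle s) (hm'.1 s)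
    _ = mixedPayoff (p i) m := by rw [← Finset.sum_mul, hm'.2, one_mul]
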